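/- Suppose f(d) ≤ C(n-(d-1)(t-1), d). Then f(d)^{[d]_t} ≤ C(n-d(t-1), d+1). (Consequently, if f(0)=1, f(1)=n and f(d+1) ≤ f(d)^{[d]_t} for all d ≥ 1, then by induction f(d) ≤ C(n-(d-1)(t-1), d) = |M_{n,d,t}| for all d ≥ 1.) -/

import Mathlib

open Finset

/-- `c` (on indices `r,...,d`) is the binomial (Macaulay) expansion of `a` with respect to `d`:
`a = C(c d, d) + ... + C(c r, r)` with `c d > ... > c r ≥ r ≥ 1`. -/
def IsMacaulayExp (d a r : ℕ) (c : ℕ → ℕ) : Prop :=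
  1 ≤ r ∧ r ≤ d ∧ r ≤ c r ∧ (∀ j, r ≤ j → j < d → c j < c (j + 1)) ∧
    a = ∑ j ∈ Finset.Icc r d, Nat.choose (c j) j

/-- The extended sequence `a_{r-1} = r-2`, `a_j = c j` for `r ≤ j ≤ d`,
`a_{d+1} = n-(d-1)(t-1)`, `a_{d+2} = a_{d+1}+(t+1)` (with integer values). -/
def extSeq (t n d r : ℕ) (c : ℕ → ℕ) : ℕ → ℤ := fun j =>
  if j = r - 1 then (r : ℤ) - 2
  else if j ≤ d then (c j : ℤ)
  else if j = d + 1 then (n : ℤ) - ((d : ℤ) - 1) * ((t : ℤ) - 1)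
  else (n : ℤ) - ((d : ℤ) - 1) * ((t : ℤ) - 1) + ((t : ℤ) + 1)

/-- binomial coefficient with integer top (zero for negative top). -/
def zchoose (x : ℤ) (m : ℕ) : ℕ := Nat.choose x.toNat m

/-- `IsSpreadPow t n d a b` says `b = a^{[d]_t}`, the `t`-spread Kruskal–Katona operator
applied to `a` (relative to `n` variables). -/
def IsSpreadPow (t n d a b : ℕ) : Prop :=
  (a = 0 ∧ b = 0) ∨
  ∃ r : ℕ, ∃ c : ℕ → ℕ, IsMacaulayExp d a r c ∧
    (let A := extSeq t n d r c
     -- k = -1 : no k in [0, d-r+1] satisfies the gap condition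
     ((∀ k : ℕ, k ≤ d - r + 1 → ¬ ((t : ℤ) + 1 ≤ A (d - k + 1) - A (d - k))) ∧
        b = zchoose ((n : ℤ) - (d : ℤ) * ((t : ℤ) - 1)) (d + 1))
     ∨
     -- k ≥ 0 : the largest k in [0, d-r+1] satisfying the gap condition
     (∃ k : ℕ, k ≤ d - r + 1 ∧ (t : ℤ) + 1 ≤ A (d - k + 1) - A (d - k) ∧
        (∀ k' : ℕ, k < k' → k' ≤ d - r + 1 → ¬ ((t : ℤ) + 1 ≤ A (d - k' + 1) - A (d - k'))) ∧
        b = (∑ j ∈ Finset.Icc (d + 1 - k) d, zchoose (A j - ((t : ℤ) - 1)) (j + 1))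
            + zchoose (A (d - k) - (2 * (t : ℤ) - 1)) (d - k + 1)
            + ∑ j ∈ Finset.Icc r (d - k), zchoose (A j) j))

lemma macaulay_sum_le (d r : ℕ) (c : ℕ → ℕ) (hmono : ∀ j, r ≤ j → j < d → c j < c (j + 1))
    (s : ℕ) (hrs : r ≤ s) (hsd : s ≤ d) :
    ∑ j ∈ Finset.Icc r s, Nat.choose (c j) j ≤ Nat.choose (c s + 1) s := by
  induction s, hrs using Nat.le_induction with
  | base => simpa using Nat.choose_le_choose r (Nat.le_succ (c r))
  | succ s hs ih =>
    rw [Finset.sum_Icc_succ_top (by omega)]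
    have h1 := ih (by omega)
    have h2 := Nat.choose_le_choose s (hmono s hs (by omega))
    have h3 := Nat.choose_succ_succ (c (s + 1)) s
    simp only [Nat.succ_eq_add_one] at *
    omega

lemma macaulay_ge (d r : ℕ) (c : ℕ → ℕ) (hr : r ≤ c r)
    (hmono : ∀ j, r ≤ j → j < d → c j < c (j + 1))
    (s : ℕ) (hrs : r ≤ s) (hsd : s ≤ d) : s ≤ c s := by
  induction s, hrs using Nat.le_induction with
  | base => exact hr
  | succ s hs ih =>
    have h1 := ih (by omega)
    have h2 := hmono s hs (by omega)
    omega

/-- telescoping of the upper part -/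
lemma upper_sum_le (d s q T : ℕ) (c : ℕ → ℕ)
    (hmono : ∀ j, s + 1 ≤ j → j < d → c j < c (j + 1))
    (hq : q ≤ c (s + 1)) (hT : T ≤ Nat.choose (c (s + 1) - q) (s + 1))
    (m : ℕ) (hsm : s + 1 ≤ m) (hmd : m ≤ d) :
    q ≤ c m ∧ ∑ j ∈ Finset.Icc (s + 1) m, Nat.choose (c j - q) (j + 1) + T
      ≤ Nat.choose (c m - q + 1) (m + 1) := by
  induction m, hsm using Nat.le_induction with
  | base =>
    refine ⟨hq, ?_⟩
    have h3 := Nat.choose_succ_succ (c (s + 1) - q) (s + 1)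
    simp only [Nat.succ_eq_add_one, Finset.Icc_self, Finset.sum_singleton] at *
    omega
  | succ m hm ih =>
    obtain ⟨h0, h1⟩ := ih (by omega)
    have h2 := hmono m hm (by omega)
    refine ⟨by omega, ?_⟩
    rw [Finset.sum_Icc_succ_top (by omega)]
    have h4 : Nat.choose (c m - q + 1) (m + 1) ≤ Nat.choose (c (m + 1) - q) (m + 1) :=
      Nat.choose_le_choose _ (by omega)
    have h3 := Nat.choose_succ_succ (c (m + 1) - q) (m + 1)
    simp only [Nat.succ_eq_add_one] at *
    omega

/-- if `f(d) ≤ C(n-(d-1)(t-1), d)`, then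
`f(d)^{[d]_t} ≤ C(n-d(t-1), d+1)`. -/
theorem spreadPow_le (n d t : ℕ) (ht : 1 ≤ t) (hd : 1 ≤ d)
    (fd b : ℕ) (hf : fd ≤ Nat.choose (n - (d - 1) * (t - 1)) d)
    (hb : IsSpreadPow t n d fd b) :
    b ≤ Nat.choose (n - d * (t - 1)) (d + 1) := by
  rcases hb with ⟨-, rfl⟩ | ⟨r, c, ⟨hr1, hrd, hrc, hmono, hsum⟩, hb⟩
  · exact Nat.zero_le _
  obtain ⟨q, rfl⟩ : ∃ q, t = q + 1 := ⟨t - 1, by omega⟩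
  obtain ⟨e, rfl⟩ : ∃ e, d = e + 1 := ⟨d - 1, by omega⟩
  simp only [Nat.add_sub_cancel] at hf ⊢
  have hge := macaulay_ge (e + 1) r c hrc hmono
  have hpos : ∀ j ∈ Finset.Icc r (e + 1), 0 < Nat.choose (c j) j := fun j hj => by
    rw [Finset.mem_Icc] at hj
    exact Nat.choose_pos (hge j hj.1 hj.2)
  have hdmem : e + 1 ∈ Finset.Icc r (e + 1) := Finset.mem_Icc.2 ⟨hrd, le_rfl⟩
  have hsingle : Nat.choose (c (e + 1)) (e + 1) ≤ fd := by
    rw [hsum]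
    exact Finset.single_le_sum (f := fun j => Nat.choose (c j) j) (fun _ _ => Nat.zero_le _) hdmem
  have hfpos : 0 < fd := lt_of_lt_of_le (hpos _ hdmem) hsingle
  obtain ⟨N, hN⟩ : ∃ N, n - e * q = N := ⟨_, rfl⟩
  rw [hN] at hf
  have hNd : e + 1 ≤ N := by
    by_contra h
    rw [Nat.choose_eq_zero_of_lt (by omega)] at hf
    omega
  have hn : n = N + e * q := by omega
  have hgoal : n - (e + 1) * q = N - q := by
    rw [hn, add_mul, one_mul]; omega
  rw [hgoal]
  have hcN : c (e + 1) ≤ N := by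
    by_contra h
    have h1 : Nat.choose (N + 1) (e + 1) ≤ Nat.choose (c (e + 1)) (e + 1) :=
      Nat.choose_le_choose _ (by omega)
    have h2 := Nat.choose_succ_succ N e
    have h3 : 0 < Nat.choose N e := Nat.choose_pos (by omega)
    simp only [Nat.succ_eq_add_one] at h2
    omega
  have hAr : extSeq (q + 1) n (e + 1) r c (r - 1) = (r : ℤ) - 2 := by simp [extSeq]
  have hAc : ∀ j, r ≤ j → j ≤ e + 1 → extSeq (q + 1) n (e + 1) r c j = c j := by
    intro j h1 h2
    have : j ≠ r - 1 := by omega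
    simp [extSeq, this, h2]
  have hAN : extSeq (q + 1) n (e + 1) r c (e + 1 + 1) = N := by
    have : e + 1 + 1 ≠ r - 1 := by omega
    simp [extSeq, this, hn]
  simp only at hb
  generalize extSeq (q + 1) n (e + 1) r c = A at *
  rcases hb with ⟨-, rfl⟩ | ⟨k, hk, hgap, -, rfl⟩
  · have : ((n : ℤ) - ((e + 1 : ℕ) : ℤ) * (((q + 1 : ℕ) : ℤ) - 1)).toNat = N - q := by
      have h : ((n : ℤ) - ((e + 1 : ℕ) : ℤ) * (((q + 1 : ℕ) : ℤ) - 1)) = (N : ℤ) - q := by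
        rw [hn]; push_cast; ring
      rw [h]; omega
    rw [zchoose, this]
  obtain ⟨s, hs⟩ : ∃ s, e + 1 - k = s := ⟨_, rfl⟩
  have hs2 : e + 1 + 1 - k = s + 1 := by omega
  have hsd : s ≤ e + 1 := by omega
  rw [hs, hs2, add_assoc]
  rw [hs] at hgap
  -- the tail
  have htail : ∀ Y : ℕ, A s + 2 ≤ Y → zchoose (A s - (2 * ((q + 1 : ℕ) : ℤ) - 1)) (s + 1)
      + ∑ j ∈ Finset.Icc r s, zchoose (A j) j ≤ Nat.choose Y (s + 1) := by
    intro Y hY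
    by_cases hrs : r ≤ s
    · have e1 : ∑ j ∈ Finset.Icc r s, zchoose (A j) j = ∑ j ∈ Finset.Icc r s, Nat.choose (c j) j := by
        refine Finset.sum_congr rfl fun j hj => ?_
        rw [Finset.mem_Icc] at hj
        rw [hAc j hj.1 (by omega), zchoose, Int.toNat_natCast]
      have e2 := macaulay_sum_le (e + 1) r c hmono s hrs hsd
      rw [hAc s hrs hsd] at hY ⊢
      have e3 : zchoose ((c s : ℤ) - (2 * ((q + 1 : ℕ) : ℤ) - 1)) (s + 1)
          ≤ Nat.choose (c s + 1) (s + 1) := Nat.choose_le_choose _ (by omega)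
      have e4 : Nat.choose (c s + 1 + 1) (s + 1) ≤ Nat.choose Y (s + 1) :=
        Nat.choose_le_choose _ (by omega)
      have e5 := Nat.choose_succ_succ (c s + 1) s
      simp only [Nat.succ_eq_add_one] at e5
      omega
    · have hsr : s = r - 1 := by omega
      rw [Finset.Icc_eq_empty hrs, Finset.sum_empty, hsr, hAr, zchoose,
        Nat.choose_eq_zero_of_lt (by omega)]
      exact Nat.zero_le _
  have hAs : -1 ≤ A s := by
    by_cases hrs : r ≤ s
    · rw [hAc s hrs hsd]; omega
    · have hsr : s = r - 1 := by omega
      rw [hsr, hAr]; omega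
  by_cases hse : s = e + 1
  · subst hse
    rw [hAN] at hgap
    rw [Finset.Icc_eq_empty (by omega), Finset.sum_empty, zero_add]
    exact htail _ (by omega)
  have hs1 : s + 1 ≤ e + 1 := by omega
  have hrs1 : r ≤ s + 1 := by omega
  rw [hAc (s + 1) hrs1 hs1] at hgap
  have hup : ∑ j ∈ Finset.Icc (s + 1) (e + 1), zchoose (A j - (((q + 1 : ℕ) : ℤ) - 1)) (j + 1)
      = ∑ j ∈ Finset.Icc (s + 1) (e + 1), Nat.choose (c j - q) (j + 1) := by
    refine Finset.sum_congr rfl fun j hj => ?_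
    rw [Finset.mem_Icc] at hj
    rw [hAc j (by omega) hj.2, zchoose]
    congr 1
    omega
  rw [hup]
  by_cases hc : c (e + 1) < N
  · obtain ⟨h1, h2⟩ := upper_sum_le (e + 1) s q _ c (fun j hj => hmono j (by omega)) (by omega)
      (htail (c (s + 1) - q) (by omega)) (e + 1) hs1 le_rfl
    exact h2.trans (Nat.choose_le_choose _ (by omega))
  · have hcN' : c (e + 1) = N := by omega
    have hre : r = e + 1 := by
      by_contra hne
      have hsub : ({r, e + 1} : Finset ℕ) ⊆ Finset.Icc r (e + 1) := by
        intro j hj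
        simp only [Finset.mem_insert, Finset.mem_singleton] at hj
        rw [Finset.mem_Icc]; omega
      have h1 := Finset.sum_le_sum_of_subset (f := fun j => Nat.choose (c j) j) hsub
      rw [Finset.sum_pair hne, ← hsum, hcN'] at h1
      have h2 := hpos r (Finset.mem_Icc.2 ⟨le_rfl, hrd⟩)
      omega
    have hse' : s = e := by omega
    have hsr : s = r - 1 := by omega
    have hz : zchoose (A s - (2 * ((q + 1 : ℕ) : ℤ) - 1)) (s + 1) = 0 := by
      rw [hsr, hAr, zchoose, Nat.choose_eq_zero_of_lt (by omega)]
    rw [hz, Finset.Icc_eq_empty (a := r) (b := s) (by omega), Finset.sum_empty, hse',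
      Finset.Icc_self, Finset.sum_singleton, hcN']
    simp
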